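/- Stability of Property (RIE) under Young perturbations: let p ∈ (2,3), let X satisfy Property (RIE) relative to p and partitions (P^n), let q ∈ [1,2) with 1/p + 1/q > 1, and let φ : [0,T] → ℝ^d be càdlàg of finite q-variation whose piecewise constant discretizations φ^n along P^n satisfy ‖φ^n − φ‖_q → 0. Then X̂ = X + φ satisfies Property (RIE) relative to p and (P^n). -/

import Mathlib

open scoped ENNReal Classical
open Filter MeasureTheory ProbabilityTheory

noncomputable section

/-- The `p`-variation of a path `X` over `[0,T]`, as an extended nonnegative real:
`(sup over partitions of Σ ‖increment‖^p)^(1/p)`. -/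
def epVar {E : Type*} [NormedAddCommGroup E] (X : ℝ → E) (p T : ℝ) : ℝ≥0∞ :=
  (⨆ (n : ℕ) (t : ℕ → ℝ) (_ : Monotone t) (_ : t 0 = 0) (_ : t n = T),
    ∑ i ∈ Finset.range n, ENNReal.ofReal (‖X (t (i + 1)) - X (t i)‖ ^ p)) ^ (1 / p)

/-- The `r`-variation of a two-parameter function `A` over `[0,T]`. -/
def epVar2 {E : Type*} [NormedAddCommGroup E] (A : ℝ → ℝ → E) (r T : ℝ) : ℝ≥0∞ :=
  (⨆ (n : ℕ) (t : ℕ → ℝ) (_ : Monotone t) (_ : t 0 = 0) (_ : t n = T),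
    ∑ i ∈ Finset.range n, ENNReal.ofReal (‖A (t i) (t (i + 1))‖ ^ r)) ^ (1 / r)

/-- Piecewise constant approximation of `X` along the partition `t 0 ≤ t 1 ≤ ... ≤ t N`. -/
def pcApprox {E : Type*} (X : ℝ → E) (N : ℕ) (t : ℕ → ℝ) (s : ℝ) : E :=
  X (t (Nat.findGreatest (fun k => t k ≤ s) N))

/-- Tensor (outer) product of two Euclidean vectors, with the Frobenius (Euclidean) norm. -/
def tp2 {d e : ℕ} (v : EuclideanSpace ℝ (Fin d)) (w : EuclideanSpace ℝ (Fin e)) :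
    EuclideanSpace ℝ (Fin d × Fin e) :=
  (WithLp.equiv 2 (Fin d × Fin e → ℝ)).symm (fun q => v q.1 * w q.2)

def tp {d : ℕ} (v w : EuclideanSpace ℝ (Fin d)) : EuclideanSpace ℝ (Fin d × Fin d) :=
  tp2 v w

/-- Clamping of `x` into the interval `[s,u]`. -/
def clamp (s u x : ℝ) : ℝ := max s (min x u)

/-- The second-level lift `𝕏ⁿ_{s,u} = ∫_s^u (Xⁿ_r − Xⁿ_s) ⊗ dXⁿ_r` of a path `Xn` which is
piecewise constant along the partition `t`, written as a left-point Riemann-Stieltjes sum. -/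
def pcLift {d : ℕ} (N : ℕ) (Xn : ℝ → EuclideanSpace ℝ (Fin d)) (t : ℕ → ℝ) (s u : ℝ) :
    EuclideanSpace ℝ (Fin d × Fin d) :=
  ∑ i ∈ Finset.range N,
    tp (Xn (clamp s u (t i)) - Xn s) (Xn (clamp s u (t (i + 1))) - Xn (clamp s u (t i)))

/-- The left-point Riemann sum `∫_0^u Xⁿ_r ⊗ dX_r = Σ_k X_{t_k} ⊗ (X_{t_{k+1}∧u} − X_{t_k∧u})`. -/
def riemannSum {d : ℕ} (N : ℕ) (X : ℝ → EuclideanSpace ℝ (Fin d)) (t : ℕ → ℝ) (u : ℝ) :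
    EuclideanSpace ℝ (Fin d × Fin d) :=
  ∑ k ∈ Finset.range N, tp (X (t k)) (X (min (t (k + 1)) u) - X (min (t k) u))

/-- The left-point Riemann sum `∫_s^u Xⁿ_{s,r} ⊗ dX_r`. -/
def mixedInt {d : ℕ} (N : ℕ) (X : ℝ → EuclideanSpace ℝ (Fin d)) (t : ℕ → ℝ) (s u : ℝ) :
    EuclideanSpace ℝ (Fin d × Fin d) :=
  ∑ i ∈ Finset.range N,
    tp (pcApprox X N t (clamp s u (t i)) - pcApprox X N t s)
      (X (clamp s u (t (i + 1))) - X (clamp s u (t i)))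

/-- A control function on the simplex `Δ_T`: nonnegative and superadditive. -/
def IsControl (T : ℝ) (w : ℝ → ℝ → ℝ) : Prop :=
  (∀ s t, 0 ≤ s → s ≤ t → t ≤ T → 0 ≤ w s t) ∧
  (∀ s u t, 0 ≤ s → s ≤ u → u ≤ t → t ≤ T → w s u + w u t ≤ w s t)

/-- Property (RIE) for a path `X` relative to `p ∈ (2,3)` and a sequence of partitions
`t n 0 ≤ ... ≤ t n (N n)` of `[0,T]` with vanishing mesh. -/
structure PropertyRIE {d : ℕ} (p T : ℝ) (X : ℝ → EuclideanSpace ℝ (Fin d))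
    (N : ℕ → ℕ) (t : ℕ → ℕ → ℝ) : Prop where
  mono : ∀ n, Monotone (t n)
  zero : ∀ n, t n 0 = 0
  top : ∀ n, t n (N n) = T
  mesh : ∀ ε > 0, ∃ m, ∀ n ≥ m, ∀ i < N n, t n (i + 1) - t n i < ε
  unif : TendstoUniformlyOn (fun n s => pcApprox X (N n) (t n) s) X atTop (Set.Icc 0 T)
  riemann : ∃ I : ℝ → EuclideanSpace ℝ (Fin d × Fin d),
    TendstoUniformlyOn (fun n u => riemannSum (N n) X (t n) u) I atTop (Set.Icc 0 T)
  control : ∃ w : ℝ → ℝ → ℝ, IsControl T w ∧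
    (∀ s u, 0 ≤ s → s ≤ u → u ≤ T → ‖X u - X s‖ ^ p ≤ w s u) ∧
    (∀ n, ∀ k ℓ : ℕ, k < ℓ → ℓ ≤ N n →
      ‖riemannSum (N n) X (t n) (t n ℓ) - riemannSum (N n) X (t n) (t n k) -
          tp (X (t n k)) (X (t n ℓ) - X (t n k))‖ ^ (p / 2) ≤ w (t n k) (t n ℓ))


section Helpers

lemma tp_apply {d : ℕ} (v w : EuclideanSpace ℝ (Fin d)) (q : Fin d × Fin d) :
    tp v w q = v q.1 * w q.2 := rfl

lemma tp_add_left {d : ℕ} (v v' w : EuclideanSpace ℝ (Fin d)) :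
    tp (v + v') w = tp v w + tp v' w := by
  ext q; simp [tp_apply, add_mul]

lemma tp_sub_left {d : ℕ} (v v' w : EuclideanSpace ℝ (Fin d)) :
    tp (v - v') w = tp v w - tp v' w := by
  ext q; simp [tp_apply, sub_mul]

lemma tp_add_right {d : ℕ} (v w w' : EuclideanSpace ℝ (Fin d)) :
    tp v (w + w') = tp v w + tp v w' := by
  ext q; simp [tp_apply, mul_add]

lemma tp_sub_right {d : ℕ} (v w w' : EuclideanSpace ℝ (Fin d)) :
    tp v (w - w') = tp v w - tp v w' := by
  ext q; simp [tp_apply, mul_sub]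

lemma tp_zero_right {d : ℕ} (v : EuclideanSpace ℝ (Fin d)) : tp v 0 = 0 := by
  ext q; simp [tp_apply]

lemma tp_zero_left {d : ℕ} (v : EuclideanSpace ℝ (Fin d)) : tp 0 v = 0 := by
  ext q; simp [tp_apply]

lemma norm_tp {d : ℕ} (v w : EuclideanSpace ℝ (Fin d)) : ‖tp v w‖ = ‖v‖ * ‖w‖ := by
  rw [EuclideanSpace.norm_eq, EuclideanSpace.norm_eq, EuclideanSpace.norm_eq,
    ← Real.sqrt_mul (by positivity), Finset.sum_mul_sum, Fintype.sum_prod_type]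
  simp [tp_apply, mul_pow]

/-- Discrete Young / sewing estimate. -/
lemma young_disc (θ : ℝ) (hθ : 1 < θ) : ∃ C : ℝ, 0 ≤ C ∧ ∀ (d : ℕ)
    (a b : ℕ → EuclideanSpace ℝ (Fin d)) (J : ℕ → EuclideanSpace ℝ (Fin d × Fin d)) (M : ℕ)
    (ω : ℕ → ℕ → ℝ) (K : ℝ), 0 ≤ K →
    (∀ i, i < M → J (i + 1) = J i + tp (a i) (b (i + 1) - b i)) →
    (∀ i j, i ≤ j → j ≤ M → 0 ≤ ω i j) →
    (∀ i j k, i ≤ j → j ≤ k → k ≤ M → ω i j + ω j k ≤ ω i k) →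
    (∀ i j k, i ≤ j → j ≤ k → k ≤ M → ‖a j - a i‖ * ‖b k - b j‖ ≤ K * ω i k ^ θ) →
    ∀ k l, k ≤ l → l ≤ M → ‖J l - J k - tp (a k) (b l - b k)‖ ≤ C * K * ω k l ^ θ := by
  have h2 : (2 : ℝ) ^ (1 - θ) < 1 := Real.rpow_lt_one_of_one_lt_of_neg (by norm_num) (by linarith)
  have h1 : 0 < 1 - (2 : ℝ) ^ (1 - θ) := by linarith
  refine ⟨2 / (1 - (2 : ℝ) ^ (1 - θ)), by positivity, ?_⟩
  set C := 2 / (1 - (2 : ℝ) ^ (1 - θ)) with hC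
  have hC0 : 0 ≤ C := by positivity
  have hCe : C * (2 : ℝ) ^ (1 - θ) + 2 = C := by
    rw [hC]; field_simp; ring
  intro d a b J M ω K hK hJ hn hs hab
  suffices H : ∀ r k l, l - k ≤ r → k ≤ l → l ≤ M →
      ‖J l - J k - tp (a k) (b l - b k)‖ ≤ C * K * ω k l ^ θ from
    fun k l => H (l - k) k l le_rfl
  intro r
  induction r with
  | zero =>
    intro k l h1 h2 h3
    have : l = k := by omega
    subst this
    have := hn l l le_rfl h3
    simp only [sub_self, tp_zero_right, norm_zero]
    positivity
  | succ r ih =>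
    intro k l hr hkl hl
    rcases hkl.eq_or_lt with rfl | hkl'
    · have := hn k k le_rfl hl
      simp only [sub_self, tp_zero_right, norm_zero]
      positivity
    have hω := hn k l hkl hl
    have hkk : ω k k ≤ 0 := by
      have := hs k k k le_rfl le_rfl (by omega); linarith
    obtain ⟨m, hkm, hml, hm1, hm2⟩ : ∃ m, k ≤ m ∧ m < l ∧ ω k m ≤ ω k l / 2 ∧
        ω (m + 1) l ≤ ω k l / 2 := by
      rcases hω.eq_or_lt with h0 | h0
      · refine ⟨k, le_rfl, hkl', by linarith, ?_⟩
        have := hs k (k+1) l (by omega) (by omega) hl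
        have := hn k (k+1) (by omega) (by omega)
        linarith
      · let P : ℕ → Prop := fun m => k ≤ m ∧ ω k m ≤ ω k l / 2
        have hPk : P k := ⟨le_rfl, by linarith⟩
        have hP : P (Nat.findGreatest P l) := Nat.findGreatest_spec hkl hPk
        have hle : Nat.findGreatest P l ≤ l := Nat.findGreatest_le l
        have hne : Nat.findGreatest P l ≠ l := by
          intro h; rw [h] at hP; have := hP.2; linarith
        have hnot : ¬ P (Nat.findGreatest P l + 1) :=
          Nat.findGreatest_is_greatest (Nat.lt_succ_self _) (by omega)
        refine ⟨Nat.findGreatest P l, hP.1, by omega, hP.2, ?_⟩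
        have h3 : ω k l / 2 < ω k (Nat.findGreatest P l + 1) := by
          by_contra hcon
          exact hnot ⟨by have := hP.1; omega, not_lt.1 hcon⟩
        have := hs k (Nat.findGreatest P l + 1) l (by have := hP.1; omega) (by omega) hl
        linarith
    have e1 := ih k m (by omega) hkm (by omega)
    have e2 := ih (m+1) l (by omega) (by omega) hl
    have c1 := hab k m l hkm (by omega) hl
    have c2 := hab m (m+1) l (by omega) (by omega) hl
    have hmono : ω m l ≤ ω k l := by
      have := hs k m l hkm (by omega) hl
      have := hn k m hkm (by omega)
      linarith
    have c2' : ‖a (m+1) - a m‖ * ‖b l - b (m+1)‖ ≤ K * ω k l ^ θ := by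
      refine c2.trans ?_
      have := hn m l (by omega) hl
      gcongr
    have key : J l - J k - tp (a k) (b l - b k) =
        (J m - J k - tp (a k) (b m - b k)) + (J l - J (m+1) - tp (a (m+1)) (b l - b (m+1)))
        + tp (a m - a k) (b l - b m) + tp (a (m+1) - a m) (b l - b (m+1)) := by
      rw [hJ m (by omega)]
      simp only [tp_sub_left, tp_sub_right]
      abel
    have half : (ω k l / 2) ^ θ * 2 = (2:ℝ) ^ (1 - θ) * ω k l ^ θ := by
      rw [Real.div_rpow hω (by norm_num), Real.rpow_sub (by norm_num), Real.rpow_one]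
      ring
    have e1' : C * K * ω k m ^ θ ≤ C * K * (ω k l / 2) ^ θ := by
      have := hn k m hkm (by omega)
      gcongr
    have e2' : C * K * ω (m+1) l ^ θ ≤ C * K * (ω k l / 2) ^ θ := by
      have := hn (m+1) l (by omega) hl
      gcongr
    rw [key]
    calc _ ≤ ‖J m - J k - tp (a k) (b m - b k)‖
          + ‖J l - J (m+1) - tp (a (m+1)) (b l - b (m+1))‖
          + ‖tp (a m - a k) (b l - b m)‖ + ‖tp (a (m+1) - a m) (b l - b (m+1))‖ :=
          norm_add₄_le
      _ ≤ C * K * (ω k l / 2) ^ θ + C * K * (ω k l / 2) ^ θ + K * ω k l ^ θ + K * ω k l ^ θ := by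
          rw [norm_tp, norm_tp]
          linarith
      _ = K * (C * ((ω k l / 2) ^ θ * 2)) + 2 * K * ω k l ^ θ := by ring
      _ = (C * (2:ℝ) ^ (1 - θ) + 2) * K * ω k l ^ θ := by rw [half]; ring
      _ = _ := by rw [hCe]

/-- Two-path Riemann sums. -/
def rsTwo {d : ℕ} (N : ℕ) (f g : ℝ → EuclideanSpace ℝ (Fin d)) (t : ℕ → ℝ) (u : ℝ) :
    EuclideanSpace ℝ (Fin d × Fin d) :=
  ∑ k ∈ Finset.range N, tp (f (t k)) (g (min (t (k + 1)) u) - g (min (t k) u))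

lemma riemannSum_add {d : ℕ} (N : ℕ) (X φ : ℝ → EuclideanSpace ℝ (Fin d)) (t : ℕ → ℝ) (u : ℝ) :
    riemannSum N (fun u => X u + φ u) t u =
      riemannSum N X t u + rsTwo N (fun u => X u + φ u) φ t u + rsTwo N φ X t u := by
  unfold riemannSum rsTwo
  rw [← Finset.sum_add_distrib, ← Finset.sum_add_distrib]
  refine Finset.sum_congr rfl fun k _ => ?_
  simp only [tp_add_left, tp_sub_right, tp_add_right]
  abel

lemma rsTwo_at {d : ℕ} (N : ℕ) (f g : ℝ → EuclideanSpace ℝ (Fin d)) (t : ℕ → ℝ)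
    (ht : Monotone t) (l : ℕ) (hl : l ≤ N) :
    rsTwo N f g t (t l) = ∑ k ∈ Finset.range l, tp (f (t k)) (g (t (k + 1)) - g (t k)) := by
  unfold rsTwo
  rw [← Finset.sum_range_add_sum_Ico _ hl]
  have h2 : ∑ k ∈ Finset.Ico l N, tp (f (t k)) (g (min (t (k + 1)) (t l)) - g (min (t k) (t l)))
      = 0 := by
    refine Finset.sum_eq_zero fun k hk => ?_
    rw [Finset.mem_Ico] at hk
    rw [min_eq_right (ht (by omega)), min_eq_right (ht hk.1), sub_self, tp_zero_right]
  rw [h2, add_zero]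
  refine Finset.sum_congr rfl fun k hk => ?_
  rw [Finset.mem_range] at hk
  rw [min_eq_left (ht (by omega)), min_eq_left (ht hk.le)]

lemma pcIdx_eq {N : ℕ} {t : ℕ → ℝ} (ht : Monotone t) {k : ℕ} (hk : k + 1 ≤ N) {s : ℝ}
    (h1 : t k ≤ s) (h2 : s < t (k + 1)) : Nat.findGreatest (fun k => t k ≤ s) N = k := by
  apply le_antisymm
  · by_contra hcon
    have hs : t (Nat.findGreatest (fun k => t k ≤ s) N) ≤ s :=
      Nat.findGreatest_spec (P := fun k => t k ≤ s) (show k ≤ N by omega) h1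
    have := ht (show k + 1 ≤ Nat.findGreatest (fun k => t k ≤ s) N by omega)
    linarith
  · exact Nat.le_findGreatest (by omega) h1

lemma tp_telescope {d : ℕ} (c : EuclideanSpace ℝ (Fin d)) (h : ℕ → EuclideanSpace ℝ (Fin d))
    (i j : ℕ) (hij : i ≤ j) :
    ∑ k ∈ Finset.Ico i j, tp c (h (k + 1) - h k) = tp c (h j - h i) := by
  induction j, hij using Nat.le_induction with
  | base => simp [tp_zero_right]
  | succ j hj ih =>
    rw [Finset.sum_Ico_succ_top hj, ih, ← tp_add_right]
    congr 1; abel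

lemma rsTwo_refine {d : ℕ} (N M : ℕ) (f g : ℝ → EuclideanSpace ℝ (Fin d)) (t s : ℕ → ℝ)
    (ht : Monotone t) (hs : ∀ i j, i < j → j ≤ M → s i < s j)
    (hst : ∀ k ≤ N, ∃ j ≤ M, s j = t k) (h0 : s 0 = t 0) (hM : s M = t N) (u : ℝ) :
    rsTwo N f g t u = ∑ j ∈ Finset.range M,
      tp (pcApprox f N t (s j)) (g (min (s (j + 1)) u) - g (min (s j) u)) := by
  have hlt : ∀ i j, i ≤ M → j ≤ M → s i ≤ s j → i ≤ j := by
    intro i j hi hj hij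
    by_contra hcon
    have := hs j i (by omega) hi
    linarith
  suffices H : ∀ k, k ≤ N → ∀ j ≤ M, s j = t k →
      ∑ i ∈ Finset.range k, tp (f (t i)) (g (min (t (i + 1)) u) - g (min (t i) u)) =
      ∑ i ∈ Finset.range j,
        tp (pcApprox f N t (s i)) (g (min (s (i + 1)) u) - g (min (s i) u)) from
    H N le_rfl M le_rfl hM
  intro k
  induction k with
  | zero =>
    intro _ j hj hjt
    have : j ≤ 0 := hlt j 0 hj (by omega) (by rw [hjt, h0])
    have : j = 0 := by omega
    subst this
    simp
  | succ k ih =>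
    intro hk j hj hjt
    obtain ⟨i, hi, hit⟩ := hst k (by omega)
    have hij : i ≤ j := hlt i j hi hj (by rw [hit, hjt]; exact ht (by omega))
    rw [Finset.sum_range_succ, ih (by omega) i hi hit, ← Finset.sum_range_add_sum_Ico _ hij]
    congr 1
    rw [← hit, ← hjt, ← tp_telescope (f (s i)) (fun k => g (min (s k) u)) i j hij]
    refine Finset.sum_congr rfl fun r hr => ?_
    rw [Finset.mem_Ico] at hr
    have h1 : t k ≤ s r := by
      rw [← hit]
      rcases hr.1.eq_or_lt with h | h
      · rw [h]
      · exact (hs i r h (by omega)).le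
    have h2 : s r < t (k+1) := by rw [← hjt]; exact hs r j hr.2 hj
    rw [pcApprox, pcIdx_eq ht hk h1 h2, hit]

lemma exists_merge (T : ℝ) (S : Finset ℝ) (h0 : (0:ℝ) ∈ S) (hT : T ∈ S)
    (hS : ∀ x ∈ S, 0 ≤ x ∧ x ≤ T) :
    ∃ (M : ℕ) (s : ℕ → ℝ), (∀ i j, i < j → j ≤ M → s i < s j) ∧ Monotone s ∧
      (∀ x ∈ S, ∃ j ≤ M, s j = x) ∧ s 0 = 0 ∧ s M = T ∧ ∀ j, 0 ≤ s j ∧ s j ≤ T := by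
  have hc : 0 < S.card := Finset.card_pos.2 ⟨_, h0⟩
  obtain ⟨M, hM⟩ : ∃ M, S.card = M + 1 := ⟨S.card - 1, by omega⟩
  let e := S.orderEmbOfFin hM
  let s : ℕ → ℝ := fun j => e ⟨min j M, by omega⟩
  have hsS : ∀ j, s j ∈ S := fun j => Finset.orderEmbOfFin_mem S hM _
  have hmono : Monotone s := by
    intro i j hij
    apply e.monotone
    rw [Fin.le_def]
    simp only
    omega
  have hex : ∀ x ∈ S, ∃ j ≤ M, s j = x := by
    intro x hx
    have : x ∈ Set.range e := by
      rw [Finset.range_orderEmbOfFin]; exact hx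
    obtain ⟨⟨j, hj⟩, rfl⟩ := this
    refine ⟨j, by omega, ?_⟩
    simp only [s]
    congr 2
    omega
  refine ⟨M, s, ?_, hmono, hex, ?_, ?_, fun j => hS _ (hsS j)⟩
  · intro i j hij hj
    apply e.strictMono
    rw [Fin.lt_def]
    simp only
    omega
  · obtain ⟨j, hj, hj0⟩ := hex 0 h0
    have := hmono (Nat.zero_le j)
    have := (hS _ (hsS 0)).1
    linarith
  · obtain ⟨j, hj, hj0⟩ := hex T hT
    have := hmono hj
    have := (hS _ (hsS M)).2
    linarith

lemma add_rpow_le_two {p a b : ℝ} (hp : 0 ≤ p) (ha : 0 ≤ a) (hb : 0 ≤ b) :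
    (a + b) ^ p ≤ 2 ^ p * (a ^ p + b ^ p) := by
  have h : a + b ≤ 2 * max a b := by
    have := le_max_left a b; have := le_max_right a b; linarith
  calc (a + b) ^ p ≤ (2 * max a b) ^ p := by gcongr
    _ = 2 ^ p * (max a b) ^ p := Real.mul_rpow (by norm_num) (by positivity)
    _ ≤ 2 ^ p * (a ^ p + b ^ p) := by
      gcongr
      have := Real.rpow_nonneg ha p
      have := Real.rpow_nonneg hb p
      rcases max_choice a b with h | h <;> rw [h] <;> linarith

lemma add_rpow_le_three {p a b c : ℝ} (hp : 0 ≤ p) (ha : 0 ≤ a) (hb : 0 ≤ b) (hc : 0 ≤ c) :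
    (a + b + c) ^ p ≤ 3 ^ p * (a ^ p + b ^ p + c ^ p) := by
  have h : a + b + c ≤ 3 * max (max a b) c := by
    have := le_max_left (max a b) c; have := le_max_right (max a b) c
    have := le_max_left a b; have := le_max_right a b
    linarith
  calc (a + b + c) ^ p ≤ (3 * max (max a b) c) ^ p := by gcongr
    _ = 3 ^ p * (max (max a b) c) ^ p := Real.mul_rpow (by norm_num) (by positivity)
    _ ≤ 3 ^ p * (a ^ p + b ^ p + c ^ p) := by
      gcongr
      have := Real.rpow_nonneg ha p
      have := Real.rpow_nonneg hb p
      have := Real.rpow_nonneg hc p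
      rcases max_choice (max a b) c with h | h <;> rw [h]
      · rcases max_choice a b with h | h <;> rw [h] <;> linarith
      · linarith

lemma IsControl.mono' {T : ℝ} {w : ℝ → ℝ → ℝ} (hw : IsControl T w) {s u s' u' : ℝ}
    (h0 : 0 ≤ s') (h1 : s' ≤ s) (h2 : s ≤ u) (h3 : u ≤ u') (h4 : u' ≤ T) : w s u ≤ w s' u' := by
  have a1 := hw.2 s' s u' h0 h1 (h2.trans h3) h4
  have a2 := hw.2 s u u' (h0.trans h1) h2 h3 h4
  have a3 := hw.1 s' s h0 h1 (by linarith)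
  have a4 := hw.1 u u' (by linarith) h3 h4
  linarith

lemma IsControl.add {T : ℝ} {w v : ℝ → ℝ → ℝ} (hw : IsControl T w) (hv : IsControl T v) :
    IsControl T (fun s u => w s u + v s u) := by
  refine ⟨fun s t h0 h1 h2 => add_nonneg (hw.1 s t h0 h1 h2) (hv.1 s t h0 h1 h2), ?_⟩
  intro s u t h0 h1 h2 h3
  have := hw.2 s u t h0 h1 h2 h3
  have := hv.2 s u t h0 h1 h2 h3
  dsimp only
  linarith

lemma IsControl.smul {T : ℝ} {w : ℝ → ℝ → ℝ} (hw : IsControl T w) {c : ℝ} (hc : 0 ≤ c) :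
    IsControl T (fun s u => c * w s u) := by
  refine ⟨fun s t h0 h1 h2 => mul_nonneg hc (hw.1 s t h0 h1 h2), ?_⟩
  intro s u t h0 h1 h2 h3
  have := hw.2 s u t h0 h1 h2 h3
  dsimp only
  rw [← mul_add]
  gcongr

lemma IsControl.rpow {T : ℝ} {w : ℝ → ℝ → ℝ} (hw : IsControl T w) {r : ℝ} (hr : 1 ≤ r) :
    IsControl T (fun s u => w s u ^ r) := by
  refine ⟨fun s t h0 h1 h2 => Real.rpow_nonneg (hw.1 s t h0 h1 h2) _, ?_⟩
  intro s u t h0 h1 h2 h3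
  have h4 := hw.2 s u t h0 h1 h2 h3
  have h5 := hw.1 s u h0 h1 (by linarith)
  have h6 := hw.1 u t (by linarith) h2 h3
  dsimp only
  refine (Real.add_rpow_le_rpow_add h5 h6 hr).trans ?_
  gcongr

/-- supremum of the `q`-variation sums over `[0,u]`. -/
def vsup {E : Type*} [NormedAddCommGroup E] (X : ℝ → E) (q u : ℝ) : ℝ≥0∞ :=
  ⨆ (n : ℕ) (t : ℕ → ℝ) (_ : Monotone t) (_ : t 0 = 0) (_ : t n = u),
    ∑ i ∈ Finset.range n, ENNReal.ofReal (‖X (t (i + 1)) - X (t i)‖ ^ q)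

lemma vsup_append {E : Type*} [NormedAddCommGroup E] (X : ℝ → E) (q s u : ℝ) (hsu : s ≤ u)
    (hs : 0 ≤ s) :
    vsup X q s + ENNReal.ofReal (‖X u - X s‖ ^ q) ≤ vsup X q u := by
  have hle : vsup X q s ≤ vsup X q u - ENNReal.ofReal (‖X u - X s‖ ^ q) ∧
      ENNReal.ofReal (‖X u - X s‖ ^ q) ≤ vsup X q u := by
    have main : ∀ (n : ℕ) (t : ℕ → ℝ), Monotone t → t 0 = 0 → t n = s →
        ∑ i ∈ Finset.range n, ENNReal.ofReal (‖X (t (i + 1)) - X (t i)‖ ^ q)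
          + ENNReal.ofReal (‖X u - X s‖ ^ q) ≤ vsup X q u := by
      intro n t ht h0 hn
      let t' : ℕ → ℝ := fun i => if i ≤ n then t i else u
      have ht' : Monotone t' := by
        intro i j hij
        simp only [t']
        split_ifs with h1 h2
        · exact ht hij
        · exact (ht h1).trans (by rw [hn]; exact hsu)
        · omega
        · exact le_rfl
      have h0' : t' 0 = 0 := by simp [t', h0]
      have hn' : t' (n+1) = u := by simp [t']
      have hsum : ∑ i ∈ Finset.range (n+1), ENNReal.ofReal (‖X (t' (i + 1)) - X (t' i)‖ ^ q)
          = ∑ i ∈ Finset.range n, ENNReal.ofReal (‖X (t (i + 1)) - X (t i)‖ ^ q)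
          + ENNReal.ofReal (‖X u - X s‖ ^ q) := by
        rw [Finset.sum_range_succ]
        congr 1
        · refine Finset.sum_congr rfl fun i hi => ?_
          rw [Finset.mem_range] at hi
          simp only [t']
          rw [if_pos (by omega), if_pos (by omega)]
        · rw [hn']; simp [t', hn]
      rw [← hsum]
      unfold vsup
      exact le_iSup_of_le (n+1) (le_iSup_of_le t' (le_iSup_of_le ht' (le_iSup_of_le h0'
        (le_iSup_of_le hn' le_rfl))))
    constructor
    · conv_lhs => unfold vsup
      refine iSup_le fun n => iSup_le fun t => iSup_le fun ht => iSup_le fun h0 =>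
        iSup_le fun hn => ?_
      exact ENNReal.le_sub_of_add_le_right ENNReal.ofReal_ne_top (main n t ht h0 hn)
    · refine le_trans le_add_self (main 1 (fun i => if i = 0 then 0 else s) ?_ ?_ ?_)
      · intro i j hij
        dsimp only
        split_ifs <;> first | omega | linarith
      · simp
      · simp
  calc _ ≤ vsup X q u - ENNReal.ofReal (‖X u - X s‖ ^ q) + ENNReal.ofReal (‖X u - X s‖ ^ q) := by
        gcongr; exact hle.1
    _ = _ := tsub_add_cancel_of_le hle.2

lemma vsup_control {E : Type*} [NormedAddCommGroup E] (X : ℝ → E) (q T : ℝ) (hq : 1 ≤ q)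
    (h : epVar X q T ≠ ⊤) :
    ∃ w : ℝ → ℝ → ℝ, IsControl T w ∧
      ∀ s u, 0 ≤ s → s ≤ u → u ≤ T → ‖X u - X s‖ ^ q ≤ w s u := by
  have hT : vsup X q T ≠ ⊤ := by
    intro hcon
    apply h
    show (vsup X q T) ^ (1 / q) = ⊤
    rw [hcon, ENNReal.top_rpow_of_pos (by positivity)]
  have hfin : ∀ u, 0 ≤ u → u ≤ T → vsup X q u ≠ ⊤ := fun u h0 h1 =>
    ne_top_of_le_ne_top hT (le_self_add.trans (vsup_append X q u T h1 h0))
  have hb : ∀ s u, 0 ≤ s → s ≤ u → u ≤ T →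
      ‖X u - X s‖ ^ q ≤ (vsup X q u).toReal - (vsup X q s).toReal := by
    intro s u h0 h1 h2
    have h3 := ENNReal.toReal_mono (hfin u (h0.trans h1) h2) (vsup_append X q s u h1 h0)
    rw [ENNReal.toReal_add (hfin s h0 (h1.trans h2)) ENNReal.ofReal_ne_top,
      ENNReal.toReal_ofReal (by positivity)] at h3
    linarith
  refine ⟨fun s u => (vsup X q u).toReal - (vsup X q s).toReal, ⟨?_, ?_⟩, hb⟩
  · intro s u h0 h1 h2
    exact le_trans (by positivity) (hb s u h0 h1 h2)
  · intro s u t _ _ _ _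
    dsimp only
    linarith

lemma norm_le_epVar {E : Type*} [NormedAddCommGroup E] (X : ℝ → E) (q T u : ℝ) (hq : 1 ≤ q)
    (h0 : 0 ≤ u) (h1 : u ≤ T) : ENNReal.ofReal ‖X u - X 0‖ ≤ epVar X q T := by
  have h2 := vsup_append X q 0 u h0 le_rfl
  have h3 := vsup_append X q u T h1 h0
  have h4 : ENNReal.ofReal (‖X u - X 0‖ ^ q) ≤ vsup X q T :=
    (le_add_self.trans h2).trans (le_self_add.trans h3)
  show _ ≤ (vsup X q T) ^ (1 / q)
  rw [← ENNReal.ofReal_rpow_of_nonneg (norm_nonneg _) (by linarith)] at h4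
  rw [one_div]
  exact (ENNReal.le_rpow_inv_iff (by linarith)).2 h4

/-- the last partition point before `s` -/
lemma pc_floor {N : ℕ} {t : ℕ → ℝ} {T : ℝ} (ht : Monotone t) (h0 : t 0 = 0) (hN : t N = T) :
    Monotone (fun s => t (Nat.findGreatest (fun k => t k ≤ s) N)) ∧
    ∀ s, 0 ≤ t (Nat.findGreatest (fun k => t k ≤ s) N) ∧
      t (Nat.findGreatest (fun k => t k ≤ s) N) ≤ T := by
  constructor
  · intro s u hsu
    apply ht
    exact Nat.findGreatest_mono_left (fun k hk => le_trans hk hsu) N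
  · intro s
    constructor
    · rw [← h0]; exact ht (Nat.zero_le _)
    · rw [← hN]; exact ht (Nat.findGreatest_le _)

lemma pc_zero {E : Type*} {N : ℕ} {t : ℕ → ℝ} (ht : Monotone t) (h0 : t 0 = 0) (f : ℝ → E) :
    pcApprox f N t 0 = f 0 := by
  unfold pcApprox
  congr 1
  apply le_antisymm
  · exact Nat.findGreatest_spec (P := fun k => t k ≤ 0) (Nat.zero_le N) h0.le
  · rw [← h0]; exact ht (Nat.zero_le _)

end Helpers

lemma rsTwo_diff {d : ℕ} (p q T lam : ℝ) (hp : 1 ≤ p) (hq : 1 ≤ q) (hl0 : 0 < lam) (hl1 : lam < 1)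
    (hθ : 1 < lam / p + 1 / q) (f g : ℝ → EuclideanSpace ℝ (Fin d))
    (wf wg : ℝ → ℝ → ℝ) (hwf : IsControl T wf) (hwg : IsControl T wg)
    (hf : ∀ s u, 0 ≤ s → s ≤ u → u ≤ T → ‖f u - f s‖ ^ p ≤ wf s u)
    (hg : ∀ s u, 0 ≤ s → s ≤ u → u ≤ T → ‖g u - g s‖ ^ q ≤ wg s u) :
    0 ≤ T → ∃ B : ℝ, 0 ≤ B ∧ ∀ (N₁ N₂ : ℕ) (t₁ t₂ : ℕ → ℝ), Monotone t₁ → Monotone t₂ →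
      t₁ 0 = 0 → t₂ 0 = 0 → t₁ N₁ = T → t₂ N₂ = T → ∀ ε : ℝ, 0 ≤ ε →
      (∀ s, 0 ≤ s → s ≤ T → ‖pcApprox f N₁ t₁ s - pcApprox f N₂ t₂ s‖ ≤ ε) →
      ∀ u, 0 ≤ u → u ≤ T →
      ‖rsTwo N₁ f g t₁ u - rsTwo N₂ f g t₂ u‖ ≤ B * (2 * ε) ^ (1 - lam) := by
  obtain ⟨C, hC0, hC⟩ := young_disc (lam / p + 1 / q) hθ
  set θ := lam / p + 1 / q with hθd
  intro hT
  refine ⟨C * (2 ^ p * (wf 0 T + wf 0 T) + wg 0 T) ^ θ, ?_, ?_⟩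
  · have := hwf.1 0 T le_rfl hT le_rfl
    have := hwg.1 0 T le_rfl hT le_rfl
    positivity
  intro N₁ N₂ t₁ t₂ ht₁ ht₂ h01 h02 hN1 hN2 ε hε hD u hu0 huT
  obtain ⟨M, s, hss, hsm, hsex, hs0, hsM, hsT⟩ := exists_merge T
    ((Finset.range (N₁ + 1)).image t₁ ∪ (Finset.range (N₂ + 1)).image t₂)
    (Finset.mem_union_left _ (Finset.mem_image.2 ⟨0, by simp, h01⟩))
    (Finset.mem_union_left _ (Finset.mem_image.2 ⟨N₁, by simp, hN1⟩))
    (by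
      intro x hx
      rcases Finset.mem_union.1 hx with hx | hx
      · obtain ⟨k, hk, rfl⟩ := Finset.mem_image.1 hx
        rw [Finset.mem_range] at hk
        exact ⟨h01 ▸ ht₁ (Nat.zero_le k), hN1 ▸ ht₁ (by omega)⟩
      · obtain ⟨k, hk, rfl⟩ := Finset.mem_image.1 hx
        rw [Finset.mem_range] at hk
        exact ⟨h02 ▸ ht₂ (Nat.zero_le k), hN2 ▸ ht₂ (by omega)⟩)
  have r1 := rsTwo_refine N₁ M f g t₁ s ht₁ hss
    (fun k hk => hsex _ (Finset.mem_union_left _ (Finset.mem_image.2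
      ⟨k, Finset.mem_range.2 (by omega), rfl⟩))) (by rw [hs0, h01]) (by rw [hsM, hN1]) u
  have r2 := rsTwo_refine N₂ M f g t₂ s ht₂ hss
    (fun k hk => hsex _ (Finset.mem_union_right _ (Finset.mem_image.2
      ⟨k, Finset.mem_range.2 (by omega), rfl⟩))) (by rw [hs0, h02]) (by rw [hsM, hN2]) u
  obtain ⟨fm1, fb1⟩ := pc_floor ht₁ h01 hN1
  obtain ⟨fm2, fb2⟩ := pc_floor ht₂ h02 hN2
  set F₁ : ℝ → ℝ := fun s => t₁ (Nat.findGreatest (fun k => t₁ k ≤ s) N₁) with hF1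
  set F₂ : ℝ → ℝ := fun s => t₂ (Nat.findGreatest (fun k => t₂ k ≤ s) N₂) with hF2
  have fb1' : ∀ s, 0 ≤ F₁ s ∧ F₁ s ≤ T := fb1
  have fb2' : ∀ s, 0 ≤ F₂ s ∧ F₂ s ≤ T := fb2
  have hb : ∀ j, 0 ≤ min (s j) u ∧ min (s j) u ≤ T := fun j =>
    ⟨le_min (hsT j).1 hu0, (min_le_left _ _).trans (hsT j).2⟩
  have hbm : Monotone (fun j => min (s j) u) := fun i j hij => min_le_min_right u (hsm hij)
  let a : ℕ → EuclideanSpace ℝ (Fin d) := fun j => f (F₁ (s j)) - f (F₂ (s j))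
  let b : ℕ → EuclideanSpace ℝ (Fin d) := fun j => g (min (s j) u)
  let J : ℕ → EuclideanSpace ℝ (Fin d × Fin d) := fun j =>
    ∑ i ∈ Finset.range j, tp (a i) (b (i + 1) - b i)
  let ω : ℕ → ℕ → ℝ := fun i j => 2 ^ p * (wf (F₁ (s i)) (F₁ (s j)) + wf (F₂ (s i)) (F₂ (s j)))
    + wg (min (s i) u) (min (s j) u)
  have n1 : ∀ i j, i ≤ j → 0 ≤ wf (F₁ (s i)) (F₁ (s j)) := fun i j hij =>
    hwf.1 _ _ (fb1' _).1 (fm1 (hsm hij)) (fb1' _).2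
  have n2 : ∀ i j, i ≤ j → 0 ≤ wf (F₂ (s i)) (F₂ (s j)) := fun i j hij =>
    hwf.1 _ _ (fb2' _).1 (fm2 (hsm hij)) (fb2' _).2
  have n3 : ∀ i j, i ≤ j → 0 ≤ wg (min (s i) u) (min (s j) u) := fun i j hij =>
    hwg.1 _ _ (hb _).1 (hbm hij) (hb _).2
  have hωn : ∀ i j, i ≤ j → 0 ≤ ω i j := by
    intro i j hij
    have := n1 i j hij; have := n2 i j hij; have := n3 i j hij
    simp only [ω]; positivity
  have hωs : ∀ i j k, i ≤ j → j ≤ k → ω i j + ω j k ≤ ω i k := by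
    intro i j k hij hjk
    have e1 := hwf.2 _ _ _ (fb1' _).1 (fm1 (hsm hij)) (fm1 (hsm hjk)) (fb1' _).2
    have e2 := hwf.2 _ _ _ (fb2' _).1 (fm2 (hsm hij)) (fm2 (hsm hjk)) (fb2' _).2
    have e3 := hwg.2 _ _ _ (hb _).1 (hbm hij) (hbm hjk) (hb _).2
    have e4 := mul_le_mul_of_nonneg_left (add_le_add e1 e2)
      (show (0:ℝ) ≤ 2 ^ p by positivity)
    simp only [ω]
    linarith
  have ha : ∀ i j, i ≤ j → ‖a j - a i‖ ^ p ≤ ω i j := by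
    intro i j hij
    have e1 := hf _ _ (fb1' (s i)).1 (fm1 (hsm hij)) (fb1' (s j)).2
    have e2 := hf _ _ (fb2' (s i)).1 (fm2 (hsm hij)) (fb2' (s j)).2
    have e3 := n3 i j hij
    have e4 : ‖a j - a i‖ ≤ ‖f (F₁ (s j)) - f (F₁ (s i))‖ + ‖f (F₂ (s j)) - f (F₂ (s i))‖ := by
      have : a j - a i = (f (F₁ (s j)) - f (F₁ (s i))) - (f (F₂ (s j)) - f (F₂ (s i))) := by
        simp only [a]; abel
      rw [this]; exact norm_sub_le _ _
    calc ‖a j - a i‖ ^ p ≤ _ := Real.rpow_le_rpow (norm_nonneg _) e4 (by linarith)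
      _ ≤ _ := add_rpow_le_two (by linarith) (norm_nonneg _) (norm_nonneg _)
      _ ≤ 2 ^ p * (wf (F₁ (s i)) (F₁ (s j)) + wf (F₂ (s i)) (F₂ (s j))) := by gcongr
      _ ≤ ω i j := by simp only [ω]; linarith
  have haε : ∀ i j, ‖a j - a i‖ ≤ 2 * ε := by
    intro i j
    have e1 : ‖a j‖ ≤ ε := hD (s j) (hsT j).1 (hsT j).2
    have e2 : ‖a i‖ ≤ ε := hD (s i) (hsT i).1 (hsT i).2
    have := norm_sub_le (a j) (a i)
    linarith
  have hbω : ∀ i j, i ≤ j → ‖b j - b i‖ ^ q ≤ ω i j := by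
    intro i j hij
    have e1 := hg _ _ (hb i).1 (hbm hij) (hb j).2
    have := n1 i j hij; have := n2 i j hij
    refine e1.trans ?_
    simp only [ω]
    have : 0 ≤ 2 ^ p * (wf (F₁ (s i)) (F₁ (s j)) + wf (F₂ (s i)) (F₂ (s j))) := by positivity
    linarith
  have hωm : ∀ i j k l, i ≤ j → j ≤ k → k ≤ l → ω j k ≤ ω i l := by
    intro i j k l h1 h2 h3
    have := hωs i j l h1 (h2.trans h3)
    have := hωs j k l h2 h3
    have := hωn i j h1
    have := hωn k l h3
    linarith
  have hab : ∀ i j k, i ≤ j → j ≤ k → k ≤ M →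
      ‖a j - a i‖ * ‖b k - b j‖ ≤ (2 * ε) ^ (1 - lam) * ω i k ^ θ := by
    intro i j k hij hjk _
    have hω := hωn i k (hij.trans hjk)
    have e1 : ‖a j - a i‖ ≤ (2 * ε) ^ (1 - lam) * ω i k ^ (lam / p) := by
      calc ‖a j - a i‖ = ‖a j - a i‖ ^ ((1 - lam) + lam) := by simp
        _ = ‖a j - a i‖ ^ (1 - lam) * ‖a j - a i‖ ^ lam :=
          Real.rpow_add_of_nonneg (norm_nonneg _) (by linarith) hl0.le
        _ = ‖a j - a i‖ ^ (1 - lam) * (‖a j - a i‖ ^ p) ^ (lam / p) := by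
          rw [← Real.rpow_mul (norm_nonneg _)]
          congr 2; field_simp
        _ ≤ (2 * ε) ^ (1 - lam) * ω i k ^ (lam / p) := by
          have h1 := haε i j
          have h2 := (ha i j hij).trans (hωm i i j k le_rfl hij hjk)
          have h3 : 0 ≤ 1 - lam := by linarith
          gcongr
    have e2 : ‖b k - b j‖ ≤ ω i k ^ (1 / q) := by
      calc ‖b k - b j‖ = (‖b k - b j‖ ^ q) ^ (1 / q) := by
            rw [← Real.rpow_mul (norm_nonneg _), mul_one_div_cancel (by linarith), Real.rpow_one]
        _ ≤ _ := by
          have := (hbω j k hjk).trans (hωm i j k k hij hjk le_rfl)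
          gcongr
    calc _ ≤ ((2 * ε) ^ (1 - lam) * ω i k ^ (lam / p)) * ω i k ^ (1 / q) := by gcongr
      _ = _ := by
        rw [hθd, Real.rpow_add_of_nonneg hω (by positivity) (by positivity), mul_assoc]
  have hfin := hC d a b J M ω ((2 * ε) ^ (1 - lam)) (by positivity)
    (fun i _ => Finset.sum_range_succ _ _) (fun i j h _ => hωn i j h)
    (fun i j k h h' _ => hωs i j k h h') hab 0 M (Nat.zero_le _) le_rfl
  have ha0 : a 0 = 0 := by
    have e1 : f (F₁ 0) = f 0 := pc_zero ht₁ h01 f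
    have e2 : f (F₂ 0) = f 0 := pc_zero ht₂ h02 f
    simp only [a, hs0, e1, e2, sub_self]
  have hJ0 : J 0 = 0 := by simp [J]
  rw [ha0, tp_zero_left, hJ0, sub_zero, sub_zero] at hfin
  have hJM : rsTwo N₁ f g t₁ u - rsTwo N₂ f g t₂ u = J M := by
    rw [r1, r2, ← Finset.sum_sub_distrib]
    refine Finset.sum_congr rfl fun i _ => ?_
    rw [← tp_sub_left]; rfl
  rw [hJM]
  refine hfin.trans ?_
  have hωT : ω 0 M ≤ 2 ^ p * (wf 0 T + wf 0 T) + wg 0 T := by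
    have e1 := hwf.mono' le_rfl (fb1' (s 0)).1 (fm1 (hsm (Nat.zero_le M))) (fb1' (s M)).2 le_rfl
    have e2 := hwf.mono' le_rfl (fb2' (s 0)).1 (fm2 (hsm (Nat.zero_le M))) (fb2' (s M)).2 le_rfl
    have e3 := hwg.mono' le_rfl (hb 0).1 (hbm (Nat.zero_le M)) (hb M).2 le_rfl
    simp only [ω]
    gcongr
  have := hωn 0 M (Nat.zero_le _)
  calc C * (2 * ε) ^ (1 - lam) * ω 0 M ^ θ
      ≤ C * (2 * ε) ^ (1 - lam) * (2 ^ p * (wf 0 T + wf 0 T) + wg 0 T) ^ θ := by gcongr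
    _ = _ := by ring

lemma rsTwo_conv {d : ℕ} (p q T : ℝ) (hT : 0 ≤ T) (hp : 1 ≤ p) (hq : 1 ≤ q)
    (hpq : 1 / p + 1 / q > 1) (f g : ℝ → EuclideanSpace ℝ (Fin d))
    (wf wg : ℝ → ℝ → ℝ) (hwf : IsControl T wf) (hwg : IsControl T wg)
    (hf : ∀ s u, 0 ≤ s → s ≤ u → u ≤ T → ‖f u - f s‖ ^ p ≤ wf s u)
    (hg : ∀ s u, 0 ≤ s → s ≤ u → u ≤ T → ‖g u - g s‖ ^ q ≤ wg s u)
    (N : ℕ → ℕ) (t : ℕ → ℕ → ℝ) (ht : ∀ n, Monotone (t n)) (h0 : ∀ n, t n 0 = 0)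
    (hN : ∀ n, t n (N n) = T)
    (hu : TendstoUniformlyOn (fun n s => pcApprox f (N n) (t n) s) f atTop (Set.Icc 0 T)) :
    ∃ I : ℝ → EuclideanSpace ℝ (Fin d × Fin d),
      TendstoUniformlyOn (fun n u => rsTwo (N n) f g (t n) u) I atTop (Set.Icc 0 T) := by
  have hcau : UniformCauchySeqOn (fun n u => rsTwo (N n) f g (t n) u) atTop (Set.Icc 0 T) := by
    have hp0 : 0 < p := by linarith
    have hq0 : 0 < q := by linarith
    set δ := 1 / p + 1 / q - 1 with hδ
    have hδ0 : 0 < δ := by linarith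
    have hq' : 1 / q ≤ 1 := by rw [div_le_one hq0]; exact hq
    have hδp : δ * p ≤ 1 := by
      have : δ ≤ 1 / p := by linarith
      calc δ * p ≤ 1 / p * p := by gcongr
        _ = 1 := by field_simp
    have hδp0 : 0 < δ * p := by positivity
    have hlam : (1 - δ * p / 2) / p = 1 / p - δ / 2 := by field_simp
    obtain ⟨B, hB0, hB⟩ := rsTwo_diff p q T (1 - δ * p / 2) hp hq (by linarith) (by linarith)
      (by rw [hlam]; linarith) f g wf wg hwf hwg hf hg hT
    rw [Metric.uniformCauchySeqOn_iff]
    intro η hη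
    set r := 1 - (1 - δ * p / 2) with hr
    have hr0 : 0 < r := by rw [hr]; linarith
    set K := η / (B + 1) with hK
    have hK0 : 0 < K := by positivity
    set ε := K ^ (1 / r) / 2 with hε
    have hε0 : 0 < ε := by positivity
    have hεr : (2 * ε) ^ r = K := by
      rw [hε, mul_div_cancel₀ _ (by norm_num), ← Real.rpow_mul hK0.le,
        one_div_mul_cancel hr0.ne', Real.rpow_one]
    have hc := Metric.uniformCauchySeqOn_iff.1 hu.uniformCauchySeqOn ε hε0
    obtain ⟨n₀, hn₀⟩ := hc
    refine ⟨n₀, fun m hm n hn u hu' => ?_⟩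
    have := hB (N m) (N n) (t m) (t n) (ht m) (ht n) (h0 m) (h0 n) (hN m) (hN n) ε hε0.le
      (fun s hs0 hsT => by
        have := hn₀ m hm n hn s ⟨hs0, hsT⟩
        rw [dist_eq_norm] at this
        exact this.le) u hu'.1 hu'.2
    rw [dist_eq_norm]
    refine this.trans_lt ?_
    rw [hεr, hK, ← mul_div_assoc, div_lt_iff₀ (by linarith)]
    nlinarith
  have hex : ∀ u : ℝ, ∃ I, u ∈ Set.Icc 0 T →
      Tendsto (fun n => rsTwo (N n) f g (t n) u) atTop (nhds I) := by
    intro u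
    by_cases h : u ∈ Set.Icc 0 T
    · obtain ⟨I, hI⟩ := cauchySeq_tendsto_of_complete (hcau.cauchySeq h)
      exact ⟨I, fun _ => hI⟩
    · exact ⟨0, fun h' => absurd h' h⟩
  choose I hI using hex
  exact ⟨I, hcau.tendstoUniformlyOn_of_tendsto fun u hu => hI u hu⟩

lemma rsTwo_ctrl {d : ℕ} (p q T θ : ℝ) (hp : 1 ≤ p) (hq : 1 ≤ q) (hθd : θ = 1 / p + 1 / q)
    (C : ℝ)
    (hC : ∀ (d : ℕ)
    (a b : ℕ → EuclideanSpace ℝ (Fin d)) (J : ℕ → EuclideanSpace ℝ (Fin d × Fin d)) (M : ℕ)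
    (ω : ℕ → ℕ → ℝ) (K : ℝ), 0 ≤ K →
    (∀ i, i < M → J (i + 1) = J i + tp (a i) (b (i + 1) - b i)) →
    (∀ i j, i ≤ j → j ≤ M → 0 ≤ ω i j) →
    (∀ i j k, i ≤ j → j ≤ k → k ≤ M → ω i j + ω j k ≤ ω i k) →
    (∀ i j k, i ≤ j → j ≤ k → k ≤ M → ‖a j - a i‖ * ‖b k - b j‖ ≤ K * ω i k ^ θ) →
    ∀ k l, k ≤ l → l ≤ M → ‖J l - J k - tp (a k) (b l - b k)‖ ≤ C * K * ω k l ^ θ)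
    (f g : ℝ → EuclideanSpace ℝ (Fin d))
    (w : ℝ → ℝ → ℝ) (hw : IsControl T w)
    (hf : ∀ s u, 0 ≤ s → s ≤ u → u ≤ T → ‖f u - f s‖ ^ p ≤ w s u)
    (hg : ∀ s u, 0 ≤ s → s ≤ u → u ≤ T → ‖g u - g s‖ ^ q ≤ w s u)
    (N : ℕ) (t : ℕ → ℝ) (ht : Monotone t) (h0 : t 0 = 0) (hN : t N = T)
    (k l : ℕ) (hkl : k ≤ l) (hl : l ≤ N) :
    ‖rsTwo N f g t (t l) - rsTwo N f g t (t k) - tp (f (t k)) (g (t l) - g (t k))‖ ≤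
      C * w (t k) (t l) ^ θ := by
  have hnn : ∀ i, 0 ≤ t i := fun i => h0 ▸ ht (Nat.zero_le i)
  have hle : ∀ i, i ≤ N → t i ≤ T := fun i hi => hN ▸ ht hi
  rw [rsTwo_at N f g t ht l hl, rsTwo_at N f g t ht k (hkl.trans hl)]
  have := hC d (fun i => f (t i)) (fun i => g (t i))
    (fun l => ∑ k ∈ Finset.range l, tp (f (t k)) (g (t (k + 1)) - g (t k))) N
    (fun i j => w (t i) (t j)) 1 zero_le_one (fun i _ => Finset.sum_range_succ _ _)
    (fun i j hij hj => hw.1 _ _ (hnn i) (ht hij) (hle j hj))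
    (fun i j k hij hjk hk => hw.2 _ _ _ (hnn i) (ht hij) (ht hjk) (hle k hk))
    (by
      intro i j k hij hjk hk
      have hω := hw.1 _ _ (hnn i) (ht (hij.trans hjk)) (hle k hk)
      have e1 : ‖f (t j) - f (t i)‖ ≤ w (t i) (t k) ^ (1 / p) := by
        calc ‖f (t j) - f (t i)‖ = (‖f (t j) - f (t i)‖ ^ p) ^ (1 / p) := by
              rw [← Real.rpow_mul (norm_nonneg _), mul_one_div_cancel (by linarith),
                Real.rpow_one]
          _ ≤ _ := by
            have := (hf _ _ (hnn i) (ht hij) (hle j (hjk.trans hk))).trans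
              (hw.mono' (hnn i) le_rfl (ht hij) (ht hjk) (hle k hk))
            gcongr
      have e2 : ‖g (t k) - g (t j)‖ ≤ w (t i) (t k) ^ (1 / q) := by
        calc ‖g (t k) - g (t j)‖ = (‖g (t k) - g (t j)‖ ^ q) ^ (1 / q) := by
              rw [← Real.rpow_mul (norm_nonneg _), mul_one_div_cancel (by linarith),
                Real.rpow_one]
          _ ≤ _ := by
            have := (hg _ _ (hnn j) (ht hjk) (hle k hk)).trans
              (hw.mono' (hnn i) (ht hij) (ht hjk) le_rfl (hle k hk))
            gcongr
      rw [hθd, one_mul, Real.rpow_add_of_nonneg hω (by positivity) (by positivity)]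
      gcongr) k l hkl hl
  simpa using this

/-- stability of Property (RIE) under perturbation by a càdlàg path of finite
`q`-variation whose discretizations converge in `q`-variation. -/
theorem RIE_stable_young (d : ℕ) (p q T : ℝ) (hp2 : 2 < p) (hp3 : p < 3)
    (hq1 : 1 ≤ q) (hq2 : q < 2) (hpq : 1 / p + 1 / q > 1) (hT : 0 < T)
    (X φ : ℝ → EuclideanSpace ℝ (Fin d)) (N : ℕ → ℕ) (t : ℕ → ℕ → ℝ)
    (hX : PropertyRIE p T X N t)
    (hφrc : ∀ s ∈ Set.Ico (0 : ℝ) T, ContinuousWithinAt φ (Set.Ici s) s)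
    (hφll : ∀ s ∈ Set.Ioc (0 : ℝ) T, ∃ L, Tendsto φ (nhdsWithin s (Set.Iio s)) (nhds L))
    (hφfin : epVar φ q T ≠ ⊤)
    (hφconv : Tendsto (fun n => epVar (fun u => pcApprox φ (N n) (t n) u - φ u) q T)
      atTop (nhds 0)) :
    PropertyRIE p T (fun u => X u + φ u) N t := by
  have hp1 : 1 ≤ p := by linarith
  have hp0 : 0 < p := by linarith
  have hq0 : 0 < q := by linarith
  obtain ⟨wX, hwX, hX1, hX2⟩ := hX.control
  obtain ⟨wφ, hwφ, hφ1⟩ := vsup_control φ q T hq1 hφfin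
  obtain ⟨C, hC0, hC⟩ := young_disc (1 / p + 1 / q) hpq
  have hqp : 1 ≤ p / q := by rw [one_le_div hq0]; linarith
  -- control for the `p`-variation of `X + φ`
  let w1 : ℝ → ℝ → ℝ := fun s u => 2 ^ p * (wX s u + wφ s u ^ (p / q))
  have hw1 : IsControl T w1 := (hwX.add (hwφ.rpow hqp)).smul (by positivity)
  have hXh1 : ∀ s u, 0 ≤ s → s ≤ u → u ≤ T → ‖(X u + φ u) - (X s + φ s)‖ ^ p ≤ w1 s u := by
    intro s u h0 h1 h2
    have e1 := hX1 s u h0 h1 h2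
    have e2 := hφ1 s u h0 h1 h2
    have e3 : ‖φ u - φ s‖ ^ p ≤ wφ s u ^ (p / q) := by
      calc ‖φ u - φ s‖ ^ p = (‖φ u - φ s‖ ^ q) ^ (p / q) := by
            rw [← Real.rpow_mul (norm_nonneg _)]
            congr 1; field_simp
        _ ≤ _ := by gcongr
    have e4 : ‖(X u + φ u) - (X s + φ s)‖ ≤ ‖X u - X s‖ + ‖φ u - φ s‖ := by
      rw [add_sub_add_comm]; exact norm_add_le _ _
    calc _ ≤ (‖X u - X s‖ + ‖φ u - φ s‖) ^ p := by gcongr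
      _ ≤ _ := add_rpow_le_two hp0.le (norm_nonneg _) (norm_nonneg _)
      _ ≤ w1 s u := by simp only [w1]; gcongr
  -- uniform convergence of the discretizations of `φ`
  have hφu : TendstoUniformlyOn (fun n s => pcApprox φ (N n) (t n) s) φ atTop (Set.Icc 0 T) := by
    rw [Metric.tendstoUniformlyOn_iff]
    intro ε hε
    have := (tendsto_order.1 hφconv).2 (ENNReal.ofReal ε) (by simpa using hε)
    filter_upwards [this] with n hn u hu
    have h1 := (norm_le_epVar (fun u => pcApprox φ (N n) (t n) u - φ u) q T u hq1
      hu.1 hu.2).trans_lt hn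
    simp only [pc_zero (hX.mono n) (hX.zero n), sub_self, sub_zero] at h1
    rw [ENNReal.ofReal_lt_ofReal_iff hε] at h1
    rw [dist_comm, dist_eq_norm]
    exact h1
  have hXhu : TendstoUniformlyOn (fun n s => pcApprox (fun u => X u + φ u) (N n) (t n) s)
      (fun u => X u + φ u) atTop (Set.Icc 0 T) := hX.unif.add hφu
  refine ⟨hX.mono, hX.zero, hX.top, hX.mesh, hXhu, ?_, ?_⟩
  · obtain ⟨I, hI⟩ := hX.riemann
    obtain ⟨I1, hI1⟩ := rsTwo_conv p q T hT.le hp1 hq1 hpq (fun u => X u + φ u) φ w1 wφ hw1 hwφ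
      hXh1 hφ1 N t hX.mono hX.zero hX.top hXhu
    obtain ⟨I2, hI2⟩ := rsTwo_conv q p T hT.le hq1 hp1 (by linarith) φ X wφ wX hwφ hwX
      hφ1 hX1 N t hX.mono hX.zero hX.top hφu
    refine ⟨fun u => I u + I1 u + I2 u, ?_⟩
    simp only [riemannSum_add]
    exact (hI.add hI1).add hI2
  · let w2 : ℝ → ℝ → ℝ := fun s u => w1 s u + (wX s u + wφ s u)
    have hw2 : IsControl T w2 := hw1.add (hwX.add hwφ)
    have hexp : 1 ≤ (1 / p + 1 / q) * (p / 2) := by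
      have : (1 / p + 1 / q) * (p / 2) = 1 / 2 + (p / q) / 2 := by field_simp
      rw [this]; linarith
    let w3 : ℝ → ℝ → ℝ := fun s u => C ^ (p / 2) * w2 s u ^ ((1 / p + 1 / q) * (p / 2))
    have hw3 : IsControl T w3 := (hw2.rpow hexp).smul (by positivity)
    refine ⟨fun s u => w1 s u + 3 ^ (p / 2) * (wX s u + (w3 s u + w3 s u)),
      hw1.add ((hwX.add (hw3.add hw3)).smul (by positivity)), ?_, ?_⟩
    · intro s u h0 h1 h2
      refine (hXh1 s u h0 h1 h2).trans ?_
      have e1 := hwX.1 s u h0 h1 h2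
      have e2 := hw3.1 s u h0 h1 h2
      have : 0 ≤ (3:ℝ) ^ (p / 2) * (wX s u + (w3 s u + w3 s u)) := by positivity
      dsimp only
      linarith
    · intro n k l hkl hl
      have hb0 : 0 ≤ t n k := hX.zero n ▸ hX.mono n (Nat.zero_le k)
      have hbl : t n k ≤ t n l := hX.mono n hkl.le
      have hbT : t n l ≤ T := hX.top n ▸ hX.mono n hl
      have le1 : ∀ s u, 0 ≤ s → s ≤ u → u ≤ T → w1 s u ≤ w2 s u := fun s u h0 h1 h2 => by
        have := hwX.1 s u h0 h1 h2; have := hwφ.1 s u h0 h1 h2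
        simp only [w2]; linarith
      have le2 : ∀ s u, 0 ≤ s → s ≤ u → u ≤ T → wX s u ≤ w2 s u := fun s u h0 h1 h2 => by
        have := hw1.1 s u h0 h1 h2; have := hwφ.1 s u h0 h1 h2
        simp only [w2]; linarith
      have le3 : ∀ s u, 0 ≤ s → s ≤ u → u ≤ T → wφ s u ≤ w2 s u := fun s u h0 h1 h2 => by
        have := hwX.1 s u h0 h1 h2; have := hw1.1 s u h0 h1 h2
        simp only [w2]; linarith
      have r0 := hX2 n k l hkl hl
      have r1 := rsTwo_ctrl p q T _ hp1 hq1 rfl C hC (fun u => X u + φ u) φ w2 hw2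
        (fun s u h0 h1 h2 => (hXh1 s u h0 h1 h2).trans (le1 s u h0 h1 h2))
        (fun s u h0 h1 h2 => (hφ1 s u h0 h1 h2).trans (le3 s u h0 h1 h2))
        (N n) (t n) (hX.mono n) (hX.zero n) (hX.top n) k l hkl.le hl
      have r2 := rsTwo_ctrl q p T _ hq1 hp1 (add_comm _ _) C hC φ X w2 hw2
        (fun s u h0 h1 h2 => (hφ1 s u h0 h1 h2).trans (le3 s u h0 h1 h2))
        (fun s u h0 h1 h2 => (hX1 s u h0 h1 h2).trans (le2 s u h0 h1 h2))
        (N n) (t n) (hX.mono n) (hX.zero n) (hX.top n) k l hkl.le hl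
      have hw20 : 0 ≤ w2 (t n k) (t n l) := hw2.1 _ _ hb0 hbl hbT
      have hpow : (C * w2 (t n k) (t n l) ^ (1 / p + 1 / q)) ^ (p / 2) = w3 (t n k) (t n l) := by
        rw [Real.mul_rpow hC0 (by positivity), ← Real.rpow_mul hw20]
      have r1' := Real.rpow_le_rpow (norm_nonneg _) r1 (show 0 ≤ p / 2 by positivity)
      have r2' := Real.rpow_le_rpow (norm_nonneg _) r2 (show 0 ≤ p / 2 by positivity)
      rw [hpow] at r1' r2'
      set A0 := riemannSum (N n) X (t n) (t n l) - riemannSum (N n) X (t n) (t n k) -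
          tp (X (t n k)) (X (t n l) - X (t n k)) with hA0
      set A1 := rsTwo (N n) (fun u => X u + φ u) φ (t n) (t n l) -
        rsTwo (N n) (fun u => X u + φ u) φ (t n) (t n k) -
        tp (X (t n k) + φ (t n k)) (φ (t n l) - φ (t n k)) with hA1
      set A2 := rsTwo (N n) φ X (t n) (t n l) - rsTwo (N n) φ X (t n) (t n k) -
        tp (φ (t n k)) (X (t n l) - X (t n k)) with hA2
      have key : riemannSum (N n) (fun u => X u + φ u) (t n) (t n l) -
          riemannSum (N n) (fun u => X u + φ u) (t n) (t n k) -
          tp (X (t n k) + φ (t n k)) ((X (t n l) + φ (t n l)) - (X (t n k) + φ (t n k))) =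
          A0 + A1 + A2 := by
        rw [riemannSum_add, riemannSum_add, hA0, hA1, hA2]
        simp only [tp_add_left, tp_sub_right, tp_add_right]
        abel
      dsimp only
      rw [key]
      have hnn1 := hw1.1 _ _ hb0 hbl hbT
      calc ‖A0 + A1 + A2‖ ^ (p / 2) ≤ (‖A0‖ + ‖A1‖ + ‖A2‖) ^ (p / 2) := by
            gcongr; exact norm_add₃_le
        _ ≤ _ := add_rpow_le_three (by positivity) (norm_nonneg _) (norm_nonneg _) (norm_nonneg _)
        _ ≤ 3 ^ (p / 2) * (wX (t n k) (t n l) + w3 (t n k) (t n l) + w3 (t n k) (t n l)) := by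
            gcongr
        _ ≤ _ := by rw [add_assoc (wX (t n k) (t n l))]; linarith
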